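/- For all x, y ∈ W, one has x ▷ y = (x ∗ (y w₀)) w₀ and x ◁ y = w₀ ((w₀ x) ∗ y). -/

import Mathlib

/-! Common setup: a finite Coxeter system, Bruhat order, and the sets
`{u * y : u ≤ x}` and `{x * v : v ≤ y}` used to characterize the
Demazure product `∗` and the operations `▷`, `◁`. -/

/-- The Bruhat order on a Coxeter group: the reflexive-transitive closure of
the relation `u → u * t`, where `t` is a reflection and right multiplication
by `t` increases length. -/
def CoxeterSystem.bruhatLE {B W : Type*} [Group W] {M : CoxeterMatrix B}
    (cs : CoxeterSystem M W) : W → W → Prop :=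
  Relation.ReflTransGen
    (fun u v => ∃ t, cs.IsReflection t ∧ v = u * t ∧ cs.length u < cs.length v)

/-- The set `{u * y : u ∈ W, u ≤ x}`. -/
def CoxeterSystem.lset {B W : Type*} [Group W] {M : CoxeterMatrix B}
    (cs : CoxeterSystem M W) (x y : W) : Set W :=
  {z | ∃ u, cs.bruhatLE u x ∧ z = u * y}

/-- The set `{x * v : v ∈ W, v ≤ y}`. -/
def CoxeterSystem.rset {B W : Type*} [Group W] {M : CoxeterMatrix B}
    (cs : CoxeterSystem M W) (x y : W) : Set W :=
  {z | ∃ v, cs.bruhatLE v y ∧ z = x * v}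

namespace CoxeterSystem

variable {B W : Type*} [Group W] {M : CoxeterMatrix B} (cs : CoxeterSystem M W)

open scoped Classical in
/-- The permutation of `W × ZMod 2` attached to a simple reflection: conjugation on the first
factor, with a flip of the sign exactly at the simple reflection itself. -/
noncomputable def signedConj (i : B) : Equiv.Perm (W × ZMod 2) :=
  Function.Involutive.toPerm
    (fun p => (cs.simple i * p.1 * cs.simple i, p.2 + if p.1 = cs.simple i then 1 else 0)) <| by
    rintro ⟨t, ε⟩
    have h : cs.simple i * t * cs.simple i = cs.simple i ↔ t = cs.simple i := by
      constructor
      · intro h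
        have := congrArg (fun z => cs.simple i * z * cs.simple i) h
        simpa [mul_assoc] using this
      · rintro rfl
        simp
    ext
    · simp [mul_assoc]
    · simp only [h, add_assoc, CharTwo.add_self_eq_zero, add_zero]

open scoped Classical in
theorem signedConj_apply (i : B) (t : W) (ε : ZMod 2) :
    cs.signedConj i (t, ε) =
      (cs.simple i * t * cs.simple i, ε + if t = cs.simple i then 1 else 0) := rfl

theorem simple_mul_pow_comm (i j : B) (n : ℕ) :
    (cs.simple i * cs.simple j) ^ n * (cs.simple j * (cs.simple i * cs.simple j) ^ n) =
      cs.simple j := by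
  induction n with
  | zero => simp
  | succ n ih =>
    nth_rewrite 1 [pow_succ]
    rw [pow_succ' _ n]
    calc _ = (cs.simple i * cs.simple j) ^ n * ((cs.simple i * (cs.simple j * cs.simple j) *
          cs.simple i) * (cs.simple j * (cs.simple i * cs.simple j) ^ n)) := by
            simp only [mul_assoc]
      _ = _ := by simpa using ih

open scoped Classical in
theorem signedConj_mul_pow_apply (i j : B) (n : ℕ) (t : W) (ε : ZMod 2) :
    ((cs.signedConj i * cs.signedConj j) ^ n) (t, ε) =
      ((cs.simple i * cs.simple j) ^ n * t * ((cs.simple i * cs.simple j) ^ n)⁻¹,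
        ε + ∑ k ∈ Finset.range (2 * n),
          if t = cs.simple j * (cs.simple i * cs.simple j) ^ k then 1 else 0) := by
  induction n with
  | zero => simp
  | succ n ih =>
    have key := cs.simple_mul_pow_comm i j n
    rw [pow_succ' (cs.signedConj i * cs.signedConj j), Equiv.Perm.mul_apply, ih,
      Equiv.Perm.mul_apply, signedConj_apply, signedConj_apply,
      show 2 * (n + 1) = 2 * n + 1 + 1 by ring, Finset.sum_range_succ, Finset.sum_range_succ]
    set r := cs.simple i * cs.simple j with hr
    have h1 : r ^ n * t * (r ^ n)⁻¹ = cs.simple j ↔ t = cs.simple j * r ^ (2 * n) := by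
      rw [mul_inv_eq_iff_eq_mul, ← mul_right_inj (r ^ n) (b := t), two_mul, pow_add,
        ← mul_assoc (cs.simple j), ← mul_assoc (r ^ n) (_ * _), key]
    have h2 : cs.simple j * (r ^ n * t * (r ^ n)⁻¹) * cs.simple j = cs.simple i ↔
        t = cs.simple j * r ^ (2 * n + 1) := by
      have e : cs.simple j * (r ^ n * t * (r ^ n)⁻¹) * cs.simple j = cs.simple i ↔
          r ^ n * t * (r ^ n)⁻¹ = cs.simple j * r := by
        rw [← mul_right_inj (cs.simple j), ← mul_left_inj (cs.simple j)]
        simp [mul_assoc, hr]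
      rw [e, mul_inv_eq_iff_eq_mul, ← mul_right_inj (r ^ n) (b := t),
        show 2 * n + 1 = n + (1 + n) by ring, pow_add, pow_add, pow_one,
        ← mul_assoc (cs.simple j) (r ^ n), ← mul_assoc (r ^ n) (_ * _), key, mul_assoc]
    ext
    · simp [pow_succ', hr, mul_assoc]
    · simp only [h1, h2, add_assoc]

theorem isLiftable_signedConj : M.IsLiftable cs.signedConj := by
  classical
  intro i j
  ext1 ⟨t, ε⟩
  rw [signedConj_mul_pow_apply, two_mul, Finset.sum_range_add]
  simp only [pow_add, cs.simple_mul_simple_pow i j, one_mul, CharTwo.add_self_eq_zero]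
  simp

/-- The action of `W` on `W × ZMod 2` extending `signedConj`. -/
noncomputable def signedConjHom : W →* Equiv.Perm (W × ZMod 2) :=
  cs.lift ⟨cs.signedConj, cs.isLiftable_signedConj⟩

/-- The parity of the number of occurrences of `t` in the right inversion sequence of any word
for `w`. -/
noncomputable def inversionParity (w t : W) : ZMod 2 := (cs.signedConjHom w (t, 0)).2

open scoped Classical in
theorem signedConjHom_wordProd_apply (ω : List B) (t : W) (ε : ZMod 2) :
    cs.signedConjHom (cs.wordProd ω) (t, ε) =
      (cs.wordProd ω * t * (cs.wordProd ω)⁻¹, ε + ((cs.rightInvSeq ω).count t : ZMod 2)) := by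
  induction ω with
  | nil => simp
  | cons i ω ih =>
    rw [wordProd_cons, map_mul, Equiv.Perm.mul_apply, ih]
    have : cs.signedConjHom (cs.simple i) = cs.signedConj i := by
      simp [signedConjHom]
    rw [this, signedConj_apply, rightInvSeq, List.count_cons]
    have h : cs.wordProd ω * t * (cs.wordProd ω)⁻¹ = cs.simple i ↔
        (cs.wordProd ω)⁻¹ * cs.simple i * cs.wordProd ω = t := by
      rw [mul_inv_eq_iff_eq_mul, mul_assoc, inv_mul_eq_iff_eq_mul, eq_comm]
    ext
    · simp [mul_assoc]
    · simp [h, add_assoc]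

open scoped Classical in
theorem inversionParity_wordProd (ω : List B) (t : W) :
    cs.inversionParity (cs.wordProd ω) t = ((cs.rightInvSeq ω).count t : ZMod 2) := by
  simp [inversionParity, signedConjHom_wordProd_apply]

theorem signedConjHom_apply (w t : W) (ε : ZMod 2) :
    cs.signedConjHom w (t, ε) = (w * t * w⁻¹, ε + cs.inversionParity w t) := by
  classical
  obtain ⟨ω, rfl⟩ := cs.wordProd_surjective w
  rw [signedConjHom_wordProd_apply, inversionParity_wordProd]

theorem inversionParity_mul (u v t : W) :
    cs.inversionParity (u * v) t =
      cs.inversionParity v t + cs.inversionParity u (v * t * v⁻¹) := by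
  rw [inversionParity, map_mul, Equiv.Perm.mul_apply, signedConjHom_apply, signedConjHom_apply]
  simp

theorem inversionParity_one (t : W) : cs.inversionParity 1 t = 0 := by
  simp [inversionParity]

open scoped Classical in
theorem inversionParity_simple (i : B) (t : W) :
    cs.inversionParity (cs.simple i) t = if t = cs.simple i then 1 else 0 := by
  simp [inversionParity, signedConjHom, signedConj_apply]

theorem IsReflection.inversionParity_self {cs : CoxeterSystem M W} {t : W} (ht : cs.IsReflection t) :
    cs.inversionParity t t = 1 := by
  obtain ⟨u, i, rfl⟩ := ht
  have h := cs.inversionParity_mul u u⁻¹ (u * cs.simple i * u⁻¹)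
  rw [mul_inv_cancel, inversionParity_one] at h
  rw [inversionParity_mul, inversionParity_mul cs u (cs.simple i)]
  simp only [inv_inv, mul_assoc, inv_mul_cancel_left, inv_mul_cancel, mul_one, one_mul,
    simple_mul_simple_self, inv_simple, inversionParity_simple, if_true] at h ⊢
  rw [add_left_comm, ← h, add_zero]

theorem isRightInversion_of_inversionParity_eq_one {w t : W}
    (h : cs.inversionParity w t = 1) : cs.IsRightInversion w t := by
  classical
  obtain ⟨ω, hω, rfl⟩ := cs.exists_isReduced w
  refine cs.isRightInversion_of_mem_rightInvSeq hω ?_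
  by_contra hn
  rw [inversionParity_wordProd, List.count_eq_zero_of_not_mem hn] at h
  simp at h

theorem isRightInversion_iff_inversionParity {w t : W} (ht : cs.IsReflection t) :
    cs.IsRightInversion w t ↔ cs.inversionParity w t = 1 := by
  refine ⟨fun h => ?_, cs.isRightInversion_of_inversionParity_eq_one⟩
  by_contra hn
  have h0 : cs.inversionParity w t = 0 := by
    generalize cs.inversionParity w t = a at hn
    revert a
    decide
  refine ht.isRightInversion_mul_left_iff.mp
    (cs.isRightInversion_of_inversionParity_eq_one ?_) h
  rw [inversionParity_mul, ht.inversionParity_self]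
  simp [h0]

theorem length_lt_length_mul_iff_inversionParity {w t : W} (ht : cs.IsReflection t) :
    cs.length w < cs.length (w * t) ↔ cs.inversionParity w t = 0 := by
  have h := cs.isRightInversion_iff_inversionParity (w := w) ht
  have hne := ht.length_mul_left_ne w
  have hz : ∀ a : ZMod 2, a = 0 ↔ ¬ a = 1 := by decide
  rw [hz, ← h]
  simp only [IsRightInversion, ht, true_and]
  omega

/-! ### Elementary properties of the Bruhat order -/

theorem bruhatLE.length_lt_or_eq {cs : CoxeterSystem M W} {u v : W} (h : cs.bruhatLE u v) :
    u = v ∨ cs.length u < cs.length v := by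
  induction h with
  | refl => exact Or.inl rfl
  | tail _ hs ih =>
    obtain ⟨t, -, -, hl⟩ := hs
    rcases ih with rfl | ih
    · exact Or.inr hl
    · exact Or.inr (ih.trans hl)

theorem bruhatLE.antisymm {cs : CoxeterSystem M W} {u v : W} (h : cs.bruhatLE u v)
    (h' : cs.bruhatLE v u) : u = v := by
  rcases h.length_lt_or_eq with h | h
  · exact h
  · rcases h'.length_lt_or_eq with h' | h'
    · exact h'.symm
    · exact absurd h h'.not_gt

theorem bruhatLE.inv {cs : CoxeterSystem M W} {u v : W} (h : cs.bruhatLE u v) :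
    cs.bruhatLE u⁻¹ v⁻¹ := by
  refine Relation.ReflTransGen.lift (·⁻¹) ?_ u v h
  rintro a b ⟨t, ht, rfl, hl⟩
  refine ⟨a * t * a⁻¹, ht.conj a, ?_, by simpa only [length_inv] using hl⟩
  simp [mul_assoc, ht.inv]

theorem bruhatLE_simple_mul {w : W} {i : B}
    (h : cs.length w < cs.length (cs.simple i * w)) : cs.bruhatLE w (cs.simple i * w) := by
  refine .single ⟨w⁻¹ * cs.simple i * w, ?_, by simp [mul_assoc], h⟩
  simpa using (cs.isReflection_simple i).conj w⁻¹

/-- The lifting property of the Bruhat order. -/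
theorem bruhatLE.simple_mul {cs : CoxeterSystem M W} {a b : W} (h : cs.bruhatLE a b) (i : B) :
    cs.bruhatLE (cs.simple i * a) b ∨
      cs.bruhatLE (cs.simple i * a) (cs.simple i * b) := by
  induction h with
  | refl => exact Or.inr .refl
  | @tail b c _ hs ih =>
    rcases ih with ih | ih
    · exact Or.inl (ih.tail hs)
    · obtain ⟨t, ht, rfl, hl⟩ := hs
      by_cases hb : b * t * b⁻¹ = cs.simple i
      · left
        convert ih using 1
        rw [← hb]
        simp
      · refine Or.inr (ih.tail ⟨t, ht, (mul_assoc _ _ _).symm, ?_⟩)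
        rw [← mul_assoc, cs.length_lt_length_mul_iff_inversionParity ht, inversionParity_mul,
          (cs.length_lt_length_mul_iff_inversionParity ht).mp hl, inversionParity_simple,
          if_neg hb, add_zero]

theorem bruhatLE.exists_mul_left {cs : CoxeterSystem M W} {v y : W} (h : cs.bruhatLE v y)
    (x : W) : ∃ u, cs.bruhatLE u x ∧ cs.bruhatLE (x * v) (u * y) := by
  induction hn : cs.length x generalizing x with
  | zero =>
    obtain rfl := cs.length_eq_zero_iff.mp hn
    exact ⟨1, .refl, by simpa using h⟩
  | succ n ih =>
    have hx : x ≠ 1 := by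
      rintro rfl
      simp at hn
    obtain ⟨i, hi⟩ := cs.exists_leftDescent_of_ne_one hx
    have hl := cs.isLeftDescent_iff.mp hi
    obtain ⟨x', rfl⟩ : ∃ x', x = cs.simple i * x' := ⟨cs.simple i * x, by simp⟩
    rw [simple_mul_simple_cancel_left] at hl
    obtain ⟨u, hu, huy⟩ := ih x' (by omega)
    have hx' : cs.bruhatLE x' (cs.simple i * x') := cs.bruhatLE_simple_mul (by omega)
    rcases huy.simple_mul i with h1 | h1
    · exact ⟨u, hu.trans hx', by rwa [mul_assoc]⟩
    · refine ⟨cs.simple i * u, ?_, by rwa [mul_assoc, mul_assoc]⟩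
      rcases hu.simple_mul i with h2 | h2
      · exact h2.trans hx'
      · exact h2

theorem bruhatLE.exists_mul_right {cs : CoxeterSystem M W} {u x : W} (h : cs.bruhatLE u x)
    (y : W) : ∃ v, cs.bruhatLE v y ∧ cs.bruhatLE (u * y) (x * v) := by
  obtain ⟨v, hv, hle⟩ := h.inv.exists_mul_left y⁻¹
  exact ⟨v⁻¹, by simpa using hv.inv, by simpa using hle.inv⟩

/-! ### The longest element -/

theorem length_longest_mul {cs : CoxeterSystem M W} {w₀ : W}
    (hw₀ : ∀ w : W, cs.length w ≤ cs.length w₀) (w : W) :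
    cs.length (w₀ * w) + cs.length w = cs.length w₀ := by
  induction hn : cs.length w generalizing w with
  | zero =>
    obtain rfl := cs.length_eq_zero_iff.mp hn
    simp
  | succ n ih =>
    have hw : w ≠ 1 := by
      rintro rfl
      simp at hn
    obtain ⟨i, hi⟩ := cs.exists_rightDescent_of_ne_one hw
    have hl := cs.isRightDescent_iff.mp hi
    obtain ⟨w, rfl⟩ : ∃ w', w = w' * cs.simple i := ⟨w * cs.simple i, by simp⟩
    rw [simple_mul_simple_cancel_right] at hl
    have ihw := ih w (by omega)
    have ht := (cs.isReflection_simple i).conj w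
    have h0 : cs.inversionParity w₀ (w * cs.simple i * w⁻¹) = 1 :=
      (cs.isRightInversion_iff_inversionParity ht).mp
        ⟨ht, lt_of_le_of_ne (hw₀ _) (ht.length_mul_left_ne w₀)⟩
    have h1 : cs.inversionParity w⁻¹ (w * cs.simple i * w⁻¹) = 0 := by
      rw [← cs.length_lt_length_mul_iff_inversionParity ht, length_inv, ← length_inv cs (_ * _)]
      simp only [mul_inv_rev, inv_inv, inv_simple, mul_assoc, inv_mul_cancel, mul_one]
      omega
    have h2 := cs.inversionParity_mul (w₀ * w) w⁻¹ (w * cs.simple i * w⁻¹)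
    rw [mul_inv_cancel_right, h0, h1, zero_add] at h2
    have h3 := (cs.isRightInversion_of_inversionParity_eq_one h2.symm).2
    simp only [inv_inv, mul_assoc, inv_mul_cancel_left, inv_mul_cancel, mul_one] at h3
    have h4 := cs.length_mul_simple (w₀ * w) i
    rw [mul_assoc] at h4
    omega

theorem length_mul_longest {cs : CoxeterSystem M W} {w₀ : W}
    (hw₀ : ∀ w : W, cs.length w ≤ cs.length w₀) (w : W) :
    cs.length (w * w₀) + cs.length w = cs.length w₀ := by
  have h := length_longest_mul (cs := cs) (w₀ := w₀⁻¹) (by simpa only [length_inv] using hw₀) w⁻¹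
  rwa [← mul_inv_rev, length_inv, length_inv, length_inv] at h

theorem longest_mul_self {cs : CoxeterSystem M W} {w₀ : W}
    (hw₀ : ∀ w : W, cs.length w ≤ cs.length w₀) : w₀ * w₀ = 1 := by
  have h := length_longest_mul hw₀ w₀
  exact cs.length_eq_zero_iff.mp (by omega)

theorem bruhatLE.longest_mul {cs : CoxeterSystem M W} {w₀ u v : W}
    (hw₀ : ∀ w : W, cs.length w ≤ cs.length w₀) (h : cs.bruhatLE u v) :
    cs.bruhatLE (w₀ * v) (w₀ * u) := by
  induction h with
  | refl => exact .refl
  | @tail b _ _ hs ih =>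
    obtain ⟨t, ht, rfl, hl⟩ := hs
    refine .head ⟨t, ht, by simp [mul_assoc, ht.mul_self], ?_⟩ ih
    have h1 := length_longest_mul hw₀ b
    have h2 := length_longest_mul hw₀ (b * t)
    omega

theorem bruhatLE.mul_longest {cs : CoxeterSystem M W} {w₀ u v : W}
    (hw₀ : ∀ w : W, cs.length w ≤ cs.length w₀) (h : cs.bruhatLE u v) :
    cs.bruhatLE (v * w₀) (u * w₀) := by
  have h' := h.inv.longest_mul (w₀ := w₀⁻¹) (by simpa only [length_inv] using hw₀)
  simpa only [mul_inv_rev, inv_inv] using h'.inv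

end CoxeterSystem

/-- For all `x y ∈ W`: `x ▷ y = (x ∗ (y w₀)) w₀` and `x ◁ y = w₀ ((w₀ x) ∗ y)`,
where `w₀` is the longest element of the finite Coxeter group `W`. -/
theorem rtr_ltr_via_star_w0 {B W : Type*} [Group W] [Finite W] {M : CoxeterMatrix B}
    (cs : CoxeterSystem M W) (star rtr ltr : W → W → W)
    (hstar : ∀ x y : W, star x y ∈ cs.lset x y ∧
      ∀ z ∈ cs.lset x y, cs.bruhatLE z (star x y))
    (hrtr : ∀ x y : W, rtr x y ∈ cs.lset x y ∧
      ∀ z ∈ cs.lset x y, cs.bruhatLE (rtr x y) z)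
    (hltr : ∀ x y : W, ltr x y ∈ cs.rset x y ∧
      ∀ z ∈ cs.rset x y, cs.bruhatLE (ltr x y) z)
    (w₀ : W) (hw₀ : ∀ w : W, cs.length w ≤ cs.length w₀)
    (x y : W) :
    rtr x y = star x (y * w₀) * w₀ ∧ ltr x y = w₀ * star (w₀ * x) y := by
  have hsq := CoxeterSystem.longest_mul_self hw₀
  constructor
  · obtain ⟨⟨u, hu, hru⟩, hmin⟩ := hrtr x y
    obtain ⟨⟨u', hu', hsu⟩, hmax⟩ := hstar x (y * w₀)
    have h : rtr x y * w₀ = star x (y * w₀) := by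
      refine (hmax _ ⟨u, hu, by rw [hru, mul_assoc]⟩).antisymm ?_
      rw [hsu, ← mul_assoc]
      exact (hmin _ ⟨u', hu', rfl⟩).mul_longest hw₀
    rw [← h, mul_assoc, hsq, mul_one]
  · obtain ⟨⟨v, hv, hlv⟩, hmin⟩ := hltr x y
    obtain ⟨⟨u, hu, hsu⟩, hmax⟩ := hstar (w₀ * x) y
    have h : w₀ * ltr x y = star (w₀ * x) y := by
      refine CoxeterSystem.bruhatLE.antisymm (cs := cs) ?_ ?_
      · obtain ⟨u', hu', hle⟩ := hv.exists_mul_left (w₀ * x)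
        rw [hlv, ← mul_assoc]
        exact hle.trans (hmax _ ⟨u', hu', rfl⟩)
      · obtain ⟨v', hv', hle⟩ := hu.exists_mul_right y
        rw [hsu]
        refine hle.trans ?_
        rw [mul_assoc]
        exact (hmin _ ⟨v', hv', rfl⟩).longest_mul hw₀
    rw [← h, ← mul_assoc, hsq, one_mul]
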